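/- The group Γ⁺ contains exactly one conjugacy class of elements of order 2 and exactly one conjugacy class of elements of order 3. -/

import Mathlib

/-- The three generators `a`, `b`, `c` of the tetrahedral group `Γ⁺`. -/
inductive Gen : Type
  | a | b | c

open FreeGroup in
/-- The relations `a² = b² = c⁵ = (bc)² = (ca)³ = (ab)⁵ = 1` of `Γ⁺`. -/
def rels : Set (FreeGroup Gen) :=
  {of Gen.a ^ 2, of Gen.b ^ 2, of Gen.c ^ 5,
    (of Gen.b * of Gen.c) ^ 2, (of Gen.c * of Gen.a) ^ 3, (of Gen.a * of Gen.b) ^ 5}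

/-- `Γ⁺ = ⟨a, b, c | a² = b² = c⁵ = (bc)² = (ca)³ = (ab)⁵ = 1⟩`. -/
abbrev GammaPlus := PresentedGroup rels


/-! ### The Coxeter group `[5,3,5]` and its geometric representation -/

/-- Coxeter matrix of `[5,3,5]`. -/
def cox535 : CoxeterMatrix (Fin 4) where
  M := !![1, 5, 2, 2; 5, 1, 3, 2; 2, 3, 1, 5; 2, 2, 5, 1]
  off_diagonal := by
    intro i j
    fin_cases i <;> fin_cases j <;> simp

abbrev W535 := cox535.Group

abbrev csW : CoxeterSystem cox535 W535 := cox535.toCoxeterSystem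

abbrev V4 := Fin 4 → ℝ

/-- The golden ratio. -/
noncomputable def gr : ℝ := Real.goldenRatio

lemma gr_sq : gr * gr = gr + 1 := by
  rw [← sq]; exact Real.goldenRatio_sq

lemma gr_pos : 0 < gr := Real.goldenRatio_pos

lemma gr_bounds : 3 / 2 < gr ∧ gr < 2 := by
  have h := gr_sq
  have h0 := gr_pos
  constructor <;> nlinarith

/-- Twice the Gram matrix. -/
noncomputable def gramA : Fin 4 → Fin 4 → ℝ :=
  ![![2, -gr, 0, 0], ![-gr, 2, -1, 0], ![0, -1, 2, -gr], ![0, 0, -gr, 2]]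

/-- The simple reflections acting on `V4`. -/
noncomputable def sRefl (i : Fin 4) : Module.End ℝ V4 where
  toFun v := fun j => if j = i then v j - ∑ k, gramA i k * v k else v j
  map_add' v w := by
    ext j
    by_cases h : j = i
    · simp only [h, if_true, Pi.add_apply, Fin.sum_univ_four]; ring
    · simp [h]
  map_smul' c v := by
    ext j
    by_cases h : j = i
    · simp only [h, if_true, Pi.smul_apply, Fin.sum_univ_four, smul_eq_mul, RingHom.id_apply]; ring
    · simp [h]

lemma sRefl_zero (v : V4) :
    sRefl 0 v = ![-v 0 + gr * v 1, v 1, v 2, v 3] := by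
  ext j; fin_cases j <;> simp [sRefl, gramA, Fin.sum_univ_four]; ring

lemma sRefl_one (v : V4) :
    sRefl 1 v = ![v 0, -v 1 + gr * v 0 + v 2, v 2, v 3] := by
  ext j; fin_cases j <;> simp [sRefl, gramA, Fin.sum_univ_four]; ring

lemma sRefl_two (v : V4) :
    sRefl 2 v = ![v 0, v 1, -v 2 + v 1 + gr * v 3, v 3] := by
  ext j; fin_cases j <;> simp [sRefl, gramA, Fin.sum_univ_four]; ring

lemma sRefl_three (v : V4) :
    sRefl 3 v = ![v 0, v 1, v 2, -v 3 + gr * v 2] := by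
  ext j; fin_cases j <;> simp [sRefl, gramA, Fin.sum_univ_four]; ring

lemma sRefl_liftable : cox535.IsLiftable sRefl := by
  have h := gr_sq
  intro i j
  apply LinearMap.ext; intro v
  fin_cases i <;> fin_cases j <;>
   (simp [cox535, pow_succ, sRefl_zero, sRefl_one, sRefl_two, sRefl_three]
    ext k; fin_cases k <;> simp <;> try grind)

/-- The geometric representation. -/
noncomputable def rho : W535 →* Module.End ℝ V4 := csW.lift ⟨sRefl, sRefl_liftable⟩

/-- The generating reflections. -/
abbrev S (i : Fin 4) : W535 := csW.simple i

/-- Coxeter length. -/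
noncomputable abbrev len (w : W535) : ℕ := csW.length w

lemma rho_S (i : Fin 4) : rho (S i) = sRefl i := csW.lift_apply_simple sRefl_liftable i

lemma rho_mul (v w : W535) (x : V4) : rho (v * w) x = rho v (rho w x) := by
  rw [map_mul]; rfl

lemma rho_mul_S (v : W535) (i : Fin 4) (x : V4) : rho (v * S i) x = rho v (sRefl i x) := by
  rw [rho_mul, rho_S]

/-- The simple roots. -/
def e (i : Fin 4) : V4 := Pi.single i 1

lemma S_cancel (w : W535) (i : Fin 4) : w * S i * S i = w :=
  csW.simple_mul_simple_cancel_right i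

/-! ### Tits' positivity theorem -/

lemma nonneg_comb (v : W535) {x y : V4} (hx : 0 ≤ rho v x) (hy : 0 ≤ rho v y) {p q : ℝ}
    (hp : 0 ≤ p) (hq : 0 ≤ q) : 0 ≤ rho v (p • x + q • y) := by
  rw [map_add, map_smul, map_smul]
  exact add_nonneg (smul_nonneg hp hx) (smul_nonneg hq hy)

lemma len_le_mul (w : W535) (i : Fin 4) : len (w * S i) ≤ len w + 1 := by
  rcases csW.length_mul_simple w i with h | h <;> simp only [len, S] <;> omega

lemma len_dich (w : W535) (i : Fin 4) : len (w * S i) = len w + 1 ∨ len (w * S i) + 1 = len w :=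
  csW.length_mul_simple w i

/-- The inductive hypothesis in Tits' theorem. -/
def TitsIH (n : ℕ) : Prop :=
  ∀ v : W535, len v < n → ∀ i, len v < len (v * S i) → 0 ≤ rho v (e i)

lemma tits2 {s t : Fin 4} (hts : sRefl t (e s) = e s) (w : W535) (ih : TitsIH (len w))
    (br : S s * S t = S t * S s)
    (hs : len w < len (w * S s)) (ht : len (w * S t) < len w) : 0 ≤ rho w (e s) := by
  obtain ⟨v1, rfl⟩ : ∃ v, w = v * S t := ⟨w * S t, (S_cancel w t).symm⟩
  rw [S_cancel] at ht
  have d0 := len_dich v1 t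
  rcases len_dich v1 s with d1 | d1
  · have a1 := ih v1 ht s (by omega)
    rwa [rho_mul_S, hts]
  · exfalso
    rw [mul_assoc, ← br, ← mul_assoc] at hs
    have := len_le_mul (v1 * S s) t
    omega

lemma tits3 {s t : Fin 4} (hts : sRefl t (e s) = e s + e t) (hss : sRefl s (e s) = - e s)
    (hst : sRefl s (e t) = e t + e s) (w : W535) (ih : TitsIH (len w))
    (br : S t * S s * S t = S s * S t * S s)
    (hs : len w < len (w * S s)) (ht : len (w * S t) < len w) : 0 ≤ rho w (e s) := by
  obtain ⟨v1, rfl⟩ : ∃ v, w = v * S t := ⟨w * S t, (S_cancel w t).symm⟩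
  rw [S_cancel] at ht
  have d0 := len_dich v1 t
  rcases len_dich v1 s with d1 | d1
  · have a1 := ih v1 ht s (by omega)
    have a2 := ih v1 ht t (by omega)
    rw [rho_mul_S, hts, map_add]
    exact add_nonneg a1 a2
  obtain ⟨v2, rfl⟩ : ∃ v, v1 = v * S s := ⟨v1 * S s, (S_cancel v1 s).symm⟩
  rw [S_cancel] at d1
  rcases len_dich v2 t with d2 | d2
  · have a2 := ih v2 (by omega) t (by omega)
    rw [rho_mul_S, hts, rho_mul_S, map_add, hss, hst]
    simpa using a2
  obtain ⟨v3, rfl⟩ : ∃ v, v2 = v * S t := ⟨v2 * S t, (S_cancel v2 t).symm⟩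
  rw [S_cancel] at d2
  exfalso
  have e1 : v3 * S t * S s * S t * S s = v3 * S s * S t := by
    have : v3 * S t * S s * S t = v3 * S s * S t * S s := by
      simpa only [mul_assoc] using congrArg (v3 * ·) br
    rw [this, S_cancel]
  rw [e1] at hs
  have := len_le_mul (v3 * S s) t
  have := len_le_mul v3 s
  omega

lemma tits5 {s t : Fin 4} (hts : sRefl t (e s) = e s + gr • e t) (hss : sRefl s (e s) = - e s)
    (htt : sRefl t (e t) = - e t)
    (hst : sRefl s (e t) = e t + gr • e s) (w : W535) (ih : TitsIH (len w))
    (br : S t * S s * S t * S s * S t = S s * S t * S s * S t * S s)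
    (hs : len w < len (w * S s)) (ht : len (w * S t) < len w) : 0 ≤ rho w (e s) := by
  have g0 := gr_pos.le
  have k1 : sRefl t (e s) = (1 : ℝ) • e s + gr • e t := by rw [hts, one_smul]
  have k2 : sRefl s ((1 : ℝ) • e s + gr • e t) = gr • e s + gr • e t := by
    rw [map_add, map_smul, map_smul, hss, hst, smul_add, smul_smul, gr_sq, add_smul]; module
  have k3 : sRefl t (gr • e s + gr • e t) = gr • e s + (1 : ℝ) • e t := by
    rw [map_add, map_smul, map_smul, hts, htt, smul_add, smul_smul, gr_sq, add_smul]; module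
  have k4 : sRefl s (gr • e s + (1 : ℝ) • e t) = e t := by
    rw [map_add, map_smul, map_smul, hss, hst]; module
  obtain ⟨v1, rfl⟩ : ∃ v, w = v * S t := ⟨w * S t, (S_cancel w t).symm⟩
  rw [S_cancel] at ht
  have d0 := len_dich v1 t
  rcases len_dich v1 s with d1 | d1
  · have a1 := ih v1 ht s (by omega)
    have a2 := ih v1 ht t (by omega)
    rw [rho_mul_S, k1]
    exact nonneg_comb _ a1 a2 zero_le_one g0
  obtain ⟨v2, rfl⟩ : ∃ v, v1 = v * S s := ⟨v1 * S s, (S_cancel v1 s).symm⟩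
  rw [S_cancel] at d1
  rcases len_dich v2 t with d2 | d2
  · have a1 := ih v2 (by omega) s (by omega)
    have a2 := ih v2 (by omega) t (by omega)
    rw [rho_mul_S, k1, rho_mul_S, k2]
    exact nonneg_comb _ a1 a2 g0 g0
  obtain ⟨v3, rfl⟩ : ∃ v, v2 = v * S t := ⟨v2 * S t, (S_cancel v2 t).symm⟩
  rw [S_cancel] at d2
  rcases len_dich v3 s with d3 | d3
  · have a1 := ih v3 (by omega) s (by omega)
    have a2 := ih v3 (by omega) t (by omega)
    rw [rho_mul_S, k1, rho_mul_S, k2, rho_mul_S, k3]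
    exact nonneg_comb _ a1 a2 g0 zero_le_one
  obtain ⟨v4, rfl⟩ : ∃ v, v3 = v * S s := ⟨v3 * S s, (S_cancel v3 s).symm⟩
  rw [S_cancel] at d3
  rcases len_dich v4 t with d4 | d4
  · have a2 := ih v4 (by omega) t (by omega)
    rw [rho_mul_S, k1, rho_mul_S, k2, rho_mul_S, k3, rho_mul_S, k4]
    exact a2
  obtain ⟨v5, rfl⟩ : ∃ v, v4 = v * S t := ⟨v4 * S t, (S_cancel v4 t).symm⟩
  rw [S_cancel] at d4
  exfalso
  have e1 : v5 * S t * S s * S t * S s * S t * S s = v5 * S s * S t * S s * S t := by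
    have : v5 * S t * S s * S t * S s * S t = v5 * S s * S t * S s * S t * S s := by
      simpa only [mul_assoc] using congrArg (v5 * ·) br
    rw [this, S_cancel]
  rw [e1] at hs
  have := len_le_mul (v5 * S s * S t * S s) t
  have := len_le_mul (v5 * S s * S t) s
  have := len_le_mul (v5 * S s) t
  have := len_le_mul v5 s
  omega

lemma S_inv (i : Fin 4) : (S i)⁻¹ = S i := csW.inv_simple i

lemma braid2 {s t : Fin 4} (h : cox535 s t = 2) : S s * S t = S t * S s := by
  have := csW.simple_mul_simple_pow s t
  rw [h, pow_two, mul_eq_one_iff_eq_inv] at this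
  rw [this, mul_inv_rev, S_inv, S_inv]

lemma braid3 {s t : Fin 4} (h : cox535 s t = 3) : S t * S s * S t = S s * S t * S s := by
  have := csW.simple_mul_simple_pow s t
  rw [h, pow_succ, pow_two] at this
  have h2 : S s * S t * S s * (S t * S s * S t) = 1 := by simpa only [mul_assoc] using this
  rw [mul_eq_one_iff_inv_eq] at h2
  rw [← h2]
  simp only [mul_inv_rev, S_inv, mul_assoc]

lemma braid5 {s t : Fin 4} (h : cox535 s t = 5) :
    S t * S s * S t * S s * S t = S s * S t * S s * S t * S s := by
  have := csW.simple_mul_simple_pow s t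
  rw [h, pow_succ, pow_succ, pow_succ, pow_two] at this
  have h2 : S s * S t * S s * S t * S s * (S t * S s * S t * S s * S t) = 1 := by
    simpa only [mul_assoc] using this
  rw [mul_eq_one_iff_inv_eq] at h2
  rw [← h2]
  simp only [mul_inv_rev, S_inv, mul_assoc]

lemma sRefl_self (s : Fin 4) : sRefl s (e s) = - e s := by
  fin_cases s <;> simp [sRefl_zero, sRefl_one, sRefl_two, sRefl_three, e] <;>
    ext k <;> fin_cases k <;> simp

lemma tits_pos : ∀ (n : ℕ) (w : W535), len w = n → ∀ s, len w < len (w * S s) →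
    0 ≤ rho w (e s) := by
  intro n
  induction n using Nat.strong_induction_on with
  | _ n IH =>
  rintro w rfl s hs
  have ih : TitsIH (len w) := fun v hv i hi => IH _ hv v rfl i hi
  by_cases h1 : w = 1
  · subst h1
    rw [map_one]
    intro k
    simp only [Pi.zero_apply, Module.End.one_apply, e, Pi.single_apply]
    split_ifs <;> norm_num
  obtain ⟨t, ht⟩ := csW.exists_rightDescent_of_ne_one h1
  have ht : len (w * S t) < len w := ht
  fin_cases s <;> fin_cases t <;> first
    | (exfalso; exact absurd hs (not_lt.mpr ht.le))
    | (refine tits2 ?_ w ih (braid2 rfl) hs ht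
       ext k; fin_cases k <;> simp [sRefl_zero, sRefl_one, sRefl_two, sRefl_three, e])
    | (refine tits3 ?_ (sRefl_self _) ?_ w ih (braid3 rfl) hs ht <;>
       ext k <;> fin_cases k <;> simp [sRefl_zero, sRefl_one, sRefl_two, sRefl_three, e])
    | (refine tits5 ?_ (sRefl_self _) (sRefl_self _) ?_ w ih (braid5 rfl) hs ht <;>
       ext k <;> fin_cases k <;> simp [sRefl_zero, sRefl_one, sRefl_two, sRefl_three, e])

lemma pos_of_lt {w : W535} {s : Fin 4} (h : len w < len (w * S s)) : 0 ≤ rho w (e s) :=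
  tits_pos _ w rfl s h

lemma neg_of_gt {w : W535} {s : Fin 4} (h : len (w * S s) < len w) : rho w (e s) ≤ 0 := by
  have h2 := @pos_of_lt (w * S s) s (by rwa [S_cancel])
  rw [rho_mul_S, sRefl_self, map_neg] at h2
  exact neg_nonneg.mp h2

/-! ### Fixed points of finite order elements -/

lemma vec_eq_sum (v : V4) : v = ∑ i, v i • e i := by
  ext k
  simp [e, Pi.single_apply]

lemma fun_eq_sum (z : V4 →ₗ[ℝ] ℝ) (v : V4) : z v = ∑ i, v i * z (e i) := by
  conv_lhs => rw [vec_eq_sum v]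
  rw [map_sum]
  simp

lemma fun_nonneg {z : V4 →ₗ[ℝ] ℝ} (hz : ∀ i, 0 ≤ z (e i)) {v : V4} (hv : 0 ≤ v) : 0 ≤ z v := by
  rw [fun_eq_sum]
  exact Finset.sum_nonneg fun i _ => mul_nonneg (hv i) (hz i)

lemma comp_S_of_zero {z : V4 →ₗ[ℝ] ℝ} {s : Fin 4} (h : z (e s) = 0) : z ∘ₗ rho (S s) = z := by
  ext1 v
  apply LinearMap.ext
  intro c
  simp only [LinearMap.comp_apply, rho_S]
  rw [fun_eq_sum z (sRefl s _), fun_eq_sum z (LinearMap.single ℝ (fun _ => ℝ) v c)]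
  apply Finset.sum_congr rfl
  intro j _
  by_cases hj : j = s
  · rw [hj, h, mul_zero, mul_zero]
  · simp [sRefl, hj]

lemma comp_mul (z : V4 →ₗ[ℝ] ℝ) (v w : W535) : z ∘ₗ rho (v * w) = (z ∘ₗ rho v) ∘ₗ rho w := by
  rw [map_mul]; rfl

lemma fix_mem {z : V4 →ₗ[ℝ] ℝ} (hz : ∀ i, 0 ≤ z (e i)) {J : Set (Fin 4)}
    (hJ : ∀ i, z (e i) = 0 → i ∈ J) : ∀ (n : ℕ) (h : W535), len h = n → z ∘ₗ rho h = z →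
    h ∈ Subgroup.closure (Set.image S J) := by
  intro n
  induction n with
  | zero =>
    intro h hl _
    rw [csW.length_eq_zero_iff.mp hl]
    exact one_mem _
  | succ n ih =>
    intro h hl hf
    have h1 : h ≠ 1 := by
      rintro rfl
      simp [len] at hl
    obtain ⟨s, hs⟩ := csW.exists_rightDescent_of_ne_one h1
    have hs : len (h * S s) < len h := hs
    have hn := neg_of_gt hs
    have z0 : z (e s) = 0 := by
      apply le_antisymm _ (hz s)
      have : z (rho h (e s)) = z (e s) := congrArg (fun f : V4 →ₗ[ℝ] ℝ => f (e s)) hf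
      have h3 := fun_nonneg hz (neg_nonneg.mpr hn)
      rw [map_neg] at h3
      linarith
    have := ih (h * S s) (by rcases len_dich h s with h | h <;> omega)
      (by rw [comp_mul, hf, comp_S_of_zero z0])
    rw [← S_cancel h s]
    exact mul_mem this (Subgroup.subset_closure ⟨s, hJ s z0, rfl⟩)

/-- A functional in the interior of the fundamental chamber. -/
def xs : V4 →ₗ[ℝ] ℝ := ∑ i, LinearMap.proj i

lemma xs_e (i : Fin 4) : xs (e i) = 1 := by
  simp [xs, e, LinearMap.sum_apply, Pi.single_apply]

lemma faithful {h : W535} (hh : xs ∘ₗ rho h = xs) : h = 1 := by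
  have := fix_mem (z := xs) (J := ∅) (fun i => by rw [xs_e]; norm_num)
    (fun i hi => by rw [xs_e] at hi; norm_num at hi) _ h rfl hh
  simpa using this

lemma eq_of_xs {v w : W535} (hh : xs ∘ₗ rho v = xs ∘ₗ rho w) : v = w := by
  have : v * w⁻¹ = 1 := by
    apply faithful
    rw [comp_mul, hh, ← comp_mul, mul_inv_cancel, map_one]
    rfl
  exact mul_inv_eq_one.mp this

/-- Roots. -/
def Rt : Set V4 := {β | ∃ w s, β = rho w (e s)}

lemma rt_dich {β : V4} (h : β ∈ Rt) : 0 ≤ β ∨ β ≤ 0 := by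
  obtain ⟨w, s, rfl⟩ := h
  rcases len_dich w s with h | h
  · exact Or.inl (pos_of_lt (by omega))
  · exact Or.inr (neg_of_gt (by omega))

lemma rt_S {β : V4} (h : β ∈ Rt) (s : Fin 4) : sRefl s β ∈ Rt := by
  obtain ⟨w, t, rfl⟩ := h
  exact ⟨S s * w, t, by rw [rho_mul, rho_S]⟩

lemma e_rt (s : Fin 4) : e s ∈ Rt := ⟨1, s, by rw [map_one]; rfl⟩

/-- The invariant quadratic form. -/
noncomputable def qf (v : V4) : ℝ :=
  v 0 * v 0 + v 1 * v 1 + v 2 * v 2 + v 3 * v 3 - gr * (v 0 * v 1) - v 1 * v 2 - gr * (v 2 * v 3)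

lemma qf_S (s : Fin 4) (v : V4) : qf (sRefl s v) = qf v := by
  fin_cases s <;> simp [sRefl_zero, sRefl_one, sRefl_two, sRefl_three, qf] <;> ring

lemma qf_rho (w : W535) : ∀ v : V4, qf (rho w v) = qf v := by
  induction w using csW.simple_induction_right with
  | one => intro v; rw [map_one]; rfl
  | mul_simple_right w i ih =>
    intro v
    have := rho_mul_S w i v
    rw [this, ih, qf_S]

lemma qf_e (s : Fin 4) : qf (e s) = 1 := by
  fin_cases s <;> simp [qf, e]

lemma qf_smul_e (s : Fin 4) (k : ℝ) : qf (k • e s) = k * k := by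
  fin_cases s <;> simp [qf, e]

lemma rt_qf {β : V4} (h : β ∈ Rt) : qf β = 1 := by
  obtain ⟨w, s, rfl⟩ := h
  rw [qf_rho, qf_e]

lemma sRefl_sRefl (s : Fin 4) (v : V4) : sRefl s (sRefl s v) = v := by
  rw [← rho_S, ← rho_mul]
  have : S s * S s = 1 := csW.simple_mul_simple_self s
  rw [this, map_one]; rfl

lemma rt_pos_S {β : V4} (h : β ∈ Rt) (h0 : 0 ≤ β) (s : Fin 4) (hs : β ≠ e s) :
    0 ≤ sRefl s β := by
  rcases rt_dich (rt_S h s) with h1 | h1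
  · exact h1
  exfalso
  have hz : ∀ j, j ≠ s → β j = 0 := by
    intro j hj
    have h2 := h1 j
    simp only [sRefl, LinearMap.coe_mk, AddHom.coe_mk, hj, if_false, Pi.zero_apply] at h2
    exact le_antisymm h2 (h0 j)
  have hk : β = β s • e s := by
    ext j
    by_cases hj : j = s
    · subst hj; simp [e]
    · simp [e, hz j hj, hj]
  have hq := rt_qf h
  rw [hk, qf_smul_e] at hq
  have hp : 0 ≤ β s := h0 s
  have : β s = 1 := by nlinarith
  rw [this, one_smul] at hk
  exact hs hk

/-- Positive roots on which `y` is negative. -/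
def NegR (y : V4 →ₗ[ℝ] ℝ) : Set V4 := {β | β ∈ Rt ∧ 0 ≤ β ∧ y β < 0}

lemma negR_S_sub (y : V4 →ₗ[ℝ] ℝ) (s : Fin 4) :
    NegR (y ∘ₗ rho (S s)) ⊆ insert (e s) (Set.image (sRefl s) (NegR y)) := by
  rintro β ⟨h1, h2, h3⟩
  by_cases hb : β = e s
  · exact Or.inl hb
  · right
    rw [LinearMap.comp_apply, rho_S] at h3
    exact ⟨sRefl s β, ⟨rt_S h1 s, rt_pos_S h1 h2 s hb, h3⟩, sRefl_sRefl s β⟩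

lemma negR_finite (w : W535) : (NegR (xs ∘ₗ rho w)).Finite := by
  induction w using csW.simple_induction_right with
  | one =>
    convert Set.finite_empty
    ext β
    simp only [NegR, Set.mem_ofPred_eq, Set.mem_empty_iff_false, iff_false]
    rintro ⟨-, h2, h3⟩
    rw [map_one] at h3
    have : 0 ≤ xs β := fun_nonneg (fun i => by rw [xs_e]; norm_num) h2
    exact absurd h3 (not_lt.mpr this)
  | mul_simple_right w i ih =>
    have := negR_S_sub (xs ∘ₗ rho w) i
    rw [← comp_mul] at this
    exact ((ih.image _).insert _).subset this

lemma negR_S_sub' {y : V4 →ₗ[ℝ] ℝ} {s : Fin 4} (hy : y (e s) < 0) :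
    NegR (y ∘ₗ rho (S s)) ⊆ Set.image (sRefl s) (NegR y \ {e s}) := by
  rintro β ⟨h1, h2, h3⟩
  rw [LinearMap.comp_apply, rho_S] at h3
  have hb : β ≠ e s := by
    rintro rfl
    rw [sRefl_self, map_neg] at h3
    linarith
  refine ⟨sRefl s β, ⟨⟨rt_S h1 s, rt_pos_S h1 h2 s hb, h3⟩, ?_⟩, sRefl_sRefl s β⟩
  intro h4
  have h5 : β = - e s := by rw [← sRefl_sRefl s β, h4, sRefl_self]
  have h6 := h2 s
  rw [h5] at h6
  simp [e] at h6
  linarith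

lemma exists_chamber : ∀ (n : ℕ) (y : V4 →ₗ[ℝ] ℝ), (NegR y).Finite → (NegR y).ncard = n →
    ∃ u, ∀ i, 0 ≤ (y ∘ₗ rho u) (e i) := by
  intro n
  induction n using Nat.strong_induction_on with
  | _ n IH =>
  rintro y hf rfl
  by_cases hy : ∀ i, 0 ≤ y (e i)
  · refine ⟨1, ?_⟩
    rw [map_one]
    exact hy
  push Not at hy
  obtain ⟨s, hs⟩ := hy
  have hsub := negR_S_sub' hs
  have hf2 : (NegR y \ {e s}).Finite := hf.subset Set.sdiff_subset
  have hmem : e s ∈ NegR y := by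
    refine ⟨e_rt s, ?_, hs⟩
    intro k
    simp only [Pi.zero_apply, e, Pi.single_apply]
    split_ifs <;> norm_num
  have hlt : (NegR (y ∘ₗ rho (S s))).ncard < (NegR y).ncard :=
    calc _ ≤ (Set.image (sRefl s) (NegR y \ {e s})).ncard := Set.ncard_le_ncard hsub (hf2.image _)
      _ ≤ (NegR y \ {e s}).ncard := Set.ncard_image_le hf2
      _ < _ := Set.ncard_sdiff_singleton_lt_of_mem hmem hf
  obtain ⟨u, hu⟩ := IH _ hlt (y ∘ₗ rho (S s)) ((hf2.image _).subset hsub) rfl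
  exact ⟨S s * u, by rw [comp_mul]; exact hu⟩

/-- A positive vector making obtuse angles with all the simple roots. -/
def pv : V4 := ![2, 3, 3, 2]

lemma pv_S (s : Fin 4) : ∃ c : ℝ, 0 ≤ c ∧ sRefl s pv = pv + c • e s := by
  obtain ⟨h1, h2⟩ := gr_bounds
  fin_cases s
  · refine ⟨-4 + gr * 3, by linarith, ?_⟩
    ext k; fin_cases k <;> simp [sRefl_zero, pv, e] <;> ring
  · refine ⟨-3 + gr * 2, by linarith, ?_⟩
    ext k; fin_cases k <;> simp [sRefl_one, pv, e] <;> ring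
  · refine ⟨-3 + gr * 2, by linarith, ?_⟩
    ext k; fin_cases k <;> simp [sRefl_two, pv, e] <;> ring
  · refine ⟨-4 + gr * 3, by linarith, ?_⟩
    ext k; fin_cases k <;> simp [sRefl_three, pv, e] <;> ring

lemma pv_le : ∀ (n : ℕ) (w : W535), len w = n → pv ≤ rho w pv := by
  intro n
  induction n with
  | zero =>
    intro h hl
    rw [csW.length_eq_zero_iff.mp hl, map_one]
    exact le_rfl
  | succ n ih =>
    intro h hl
    have h1 : h ≠ 1 := by
      rintro rfl
      simp [len] at hl
    obtain ⟨s, hs⟩ := csW.exists_rightDescent_of_ne_one h1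
    have hs : len (h * S s) < len h := hs
    have h2 := ih (h * S s) (by rcases len_dich h s with h | h <;> omega)
    have h3 := @pos_of_lt (h * S s) s (by rwa [S_cancel])
    obtain ⟨c, hc, hc2⟩ := pv_S s
    rw [← S_cancel h s, rho_mul_S, hc2, map_add, map_smul]
    exact h2.trans (le_add_of_nonneg_right (smul_nonneg hc h3))

lemma xs_pv_pos (w : W535) : 0 < xs (rho w pv) := by
  have h := pv_le _ w rfl
  have h0 := h 0
  have h1 := h 1
  have h2 := h 2
  have h3 := h 3
  simp only [pv] at h0 h1 h2 h3
  simp [xs, LinearMap.sum_apply, Fin.sum_univ_four]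
  simp at h0 h1 h2 h3
  simp only [pv]
  linarith

theorem finite_order_parabolic {g : W535} {n : ℕ} (hn : 0 < n) (hg : g ^ n = 1) :
    ∃ (u : W535) (k : Fin 4), u⁻¹ * g * u ∈ Subgroup.closure (Set.image S {k}ᶜ) := by
  set y : V4 →ₗ[ℝ] ℝ := ∑ i ∈ Finset.range n, xs ∘ₗ rho (g ^ i) with hy
  have hyapp : ∀ v, y v = ∑ i ∈ Finset.range n, xs (rho (g ^ i) v) := by
    intro v
    rw [hy, LinearMap.sum_apply]; rfl
  have hyg : y ∘ₗ rho g = y := by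
    apply LinearMap.ext
    intro v
    rw [LinearMap.comp_apply, hyapp, hyapp]
    have h1 : ∀ i, xs (rho (g ^ i) (rho g v)) = xs (rho (g ^ (i + 1)) v) := by
      intro i
      rw [pow_succ, rho_mul]
    simp only [h1]
    have h2 := Finset.sum_range_succ (fun i => xs (rho (g ^ i) v)) n
    rw [Finset.sum_range_succ' (fun i => xs (rho (g ^ i) v)) n, hg, pow_zero] at h2
    linarith
  have hfin : (NegR y).Finite := by
    have : NegR y ⊆ ⋃ i ∈ Finset.range n, NegR (xs ∘ₗ rho (g ^ i)) := by
      rintro β ⟨h1, h2, h3⟩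
      rw [hyapp] at h3
      obtain ⟨i, hi, hi2⟩ := Finset.exists_lt_of_sum_lt
        (f := fun i => xs (rho (g ^ i) β)) (g := fun _ => (0 : ℝ)) (by simpa using h3)
      simp only [Set.mem_iUnion]
      exact ⟨i, hi, h1, h2, hi2⟩
    refine Set.Finite.subset ?_ this
    exact Set.Finite.biUnion (Finset.finite_toSet _) fun i _ => negR_finite _
  obtain ⟨u, hu⟩ := exists_chamber _ y hfin rfl
  have hne : ∃ k, (y ∘ₗ rho u) (e k) ≠ 0 := by
    by_contra hcon
    push Not at hcon
    have h1 : y pv = 0 := by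
      have h2 := fun_eq_sum (y ∘ₗ rho u) (rho u⁻¹ pv)
      rw [LinearMap.comp_apply, ← rho_mul, mul_inv_cancel, map_one] at h2
      simp only [hcon, mul_zero, Finset.sum_const_zero] at h2
      exact h2
    rw [hyapp] at h1
    have : 0 < ∑ i ∈ Finset.range n, xs (rho (g ^ i) pv) :=
      Finset.sum_pos (fun i _ => xs_pv_pos _) ⟨0, Finset.mem_range.mpr hn⟩
    linarith
  obtain ⟨k, hk⟩ := hne
  refine ⟨u, k, fix_mem hu (J := {k}ᶜ) ?_ _ _ rfl ?_⟩
  · rintro i hi rfl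
    exact hk hi
  · rw [← comp_mul, mul_assoc, mul_inv_cancel_left, comp_mul, hyg]

/-! ### Exact computation in the Coxeter group -/

/-- Four numbers `a + b φ`, the values of a functional on the simple roots. -/
structure NV where
  a0 : ℤ
  b0 : ℤ
  a1 : ℤ
  b1 : ℤ
  a2 : ℤ
  b2 : ℤ
  a3 : ℤ
  b3 : ℤ

/-- Right action of the simple reflections on functionals. -/
def NV.step (v : NV) (s : Fin 4) : NV :=
  match v, s with
  | ⟨a0, b0, a1, b1, a2, b2, a3, b3⟩, 0 =>
    ⟨-a0, -b0, a1 + b0, b1 + (a0 + b0), a2, b2, a3, b3⟩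
  | ⟨a0, b0, a1, b1, a2, b2, a3, b3⟩, 1 =>
    ⟨a0 + b1, b0 + (a1 + b1), -a1, -b1, a2 + a1, b2 + b1, a3, b3⟩
  | ⟨a0, b0, a1, b1, a2, b2, a3, b3⟩, 2 =>
    ⟨a0, b0, a1 + a2, b1 + b2, -a2, -b2, a3 + b2, b3 + (a2 + b2)⟩
  | ⟨a0, b0, a1, b1, a2, b2, a3, b3⟩, 3 =>
    ⟨a0, b0, a1, b1, a2 + b3, b2 + (a3 + b3), -a3, -b3⟩

/-- Equality test for integers that reduces quickly in the kernel. -/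
def intEqb : ℤ → ℤ → Bool
  | Int.ofNat m, Int.ofNat n => Nat.beq m n
  | Int.negSucc m, Int.negSucc n => Nat.beq m n
  | _, _ => false

lemma intEqb_eq {a b : ℤ} (h : intEqb a b = true) : a = b := by
  cases a <;> cases b <;> simp_all [intEqb]

/-- Equality test. -/
def NV.eqb (v w : NV) : Bool :=
  intEqb v.a0 w.a0 && (intEqb v.b0 w.b0 && (intEqb v.a1 w.a1 && (intEqb v.b1 w.b1 &&
  (intEqb v.a2 w.a2 && (intEqb v.b2 w.b2 && (intEqb v.a3 w.a3 && intEqb v.b3 w.b3))))))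

lemma NV.eq_of_eqb {v w : NV} (h : v.eqb w = true) : v = w := by
  cases v; cases w
  simp only [NV.eqb, Bool.and_eq_true] at h
  obtain ⟨h0, h1, h2, h3, h4, h5, h6, h7⟩ := h
  rw [intEqb_eq h0, intEqb_eq h1, intEqb_eq h2, intEqb_eq h3, intEqb_eq h4, intEqb_eq h5,
    intEqb_eq h6, intEqb_eq h7]

/-- Real values. -/
noncomputable def NV.val (v : NV) : V4 :=
  ![v.a0 + v.b0 * gr, v.a1 + v.b1 * gr, v.a2 + v.b2 * gr, v.a3 + v.b3 * gr]

/-- Evaluation of a word on the base functional. -/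
def wv (w : List (Fin 4)) : NV := w.foldl NV.step ⟨1, 0, 1, 0, 1, 0, 1, 0⟩

/-- Element given by a word. -/
noncomputable def wp (w : List (Fin 4)) : W535 := csW.wordProd w

lemma wp_append (v w : List (Fin 4)) : wp (v ++ w) = wp v * wp w := csW.wordProd_append v w
lemma wp_cons (i : Fin 4) (w : List (Fin 4)) : wp (i :: w) = S i * wp w := csW.wordProd_cons i w
lemma wp_nil : wp [] = 1 := csW.wordProd_nil

lemma step_val (z : V4 →ₗ[ℝ] ℝ) (v : NV) (s : Fin 4) (h : ∀ j, z (e j) = v.val j) :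
    ∀ j, (z ∘ₗ rho (S s)) (e j) = (v.step s).val j := by
  intro j
  have hg := gr_sq
  have h0 := h 0
  have h1 := h 1
  have h2 := h 2
  have h3 := h 3
  rw [LinearMap.comp_apply, rho_S, fun_eq_sum, Fin.sum_univ_four, h0, h1, h2, h3]
  cases v
  fin_cases s <;> fin_cases j <;>
    simp [sRefl_zero, sRefl_one, sRefl_two, sRefl_three, e, NV.step, NV.val] <;> grind

lemma foldl_val (w : List (Fin 4)) : ∀ (z : V4 →ₗ[ℝ] ℝ) (v : NV), (∀ j, z (e j) = v.val j) →
    ∀ j, (z ∘ₗ rho (wp w)) (e j) = (w.foldl NV.step v).val j := by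
  induction w with
  | nil => intro z v h j; rw [wp_nil, map_one]; exact h j
  | cons i w ih =>
    intro z v h j
    rw [wp_cons, comp_mul, List.foldl_cons]
    exact ih _ _ (step_val z v i h) j

lemma wp_eq {v w : List (Fin 4)} (h : (wv v).eqb (wv w) = true) : wp v = wp w := by
  apply eq_of_xs
  have h0 : ∀ j, xs (e j) = (NV.mk 1 0 1 0 1 0 1 0).val j := by
    intro j
    rw [xs_e]
    fin_cases j <;> simp [NV.val]
  apply LinearMap.ext
  intro x
  rw [fun_eq_sum, fun_eq_sum (xs ∘ₗ rho (wp w))]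
  apply Finset.sum_congr rfl
  intro j _
  rw [foldl_val v xs _ h0, foldl_val w xs _ h0]
  have := NV.eq_of_eqb h
  rw [wv, wv] at this
  rw [this]

/-- Elements of the dihedral group generated by the first two reflections. -/
def dihL : List (List (Fin 4)) :=
  [[], [0], [1], [0, 1], [1, 0], [0, 1, 0], [1, 0, 1], [0, 1, 0, 1], [1, 0, 1, 0], [0, 1, 0, 1, 0]]

/-- Coset representatives of that dihedral group in `H₃`. -/
def cosL : List (List (Fin 4)) :=
  [[], [2], [1, 2], [0, 1, 2], [1, 0, 1, 2], [0, 1, 0, 1, 2], [2, 1, 0, 1, 2], [0, 2, 1, 0, 1, 2],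
    [1, 0, 2, 1, 0, 1, 2], [0, 1, 0, 2, 1, 0, 1, 2], [1, 0, 1, 0, 2, 1, 0, 1, 2],
    [2, 1, 0, 1, 0, 2, 1, 0, 1, 2]]

/-- The diagram symmetry. -/
def flipF (i : Fin 4) : Fin 4 :=
  match i with
  | 0 => 3
  | 1 => 2
  | 2 => 1
  | 3 => 0

/-- All products. -/
def prodL (A B : List (List (Fin 4))) : List (List (Fin 4)) :=
  A.flatMap fun a => B.map fun b => a ++ b

/-- The elements of the maximal parabolic subgroup omitting `k`. -/
def parL (k : Fin 4) : List (List (Fin 4)) :=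
  match k with
  | 3 => prodL cosL dihL
  | 2 => prodL [[], [3]] dihL
  | 1 => (prodL [[], [3]] dihL).map (List.map flipF)
  | 0 => (prodL cosL dihL).map (List.map flipF)

/-- Words carrying `s₀ s₂` into the parabolic subgroup omitting `k`. -/
def carry (k : Fin 4) : List (Fin 4) :=
  match k with
  | 3 => []
  | 2 => [2, 3, 2, 3]
  | 1 => []
  | 0 => [0, 1, 0, 1, 2, 3, 2, 3]

/-- The list is closed under right multiplication by the generators. -/
def closedB (k s : Fin 4) : Bool :=
  (parL k).all fun w => (parL k).any fun u => (wv (w ++ [s])).eqb (wv u)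

/-- Parity of the length of a word. -/
def evenB : List (Fin 4) → Bool
  | [] => true
  | _ :: w => !evenB w

/-- Classification of the even elements in the list. -/
def classB (k : Fin 4) : Bool :=
  (parL k).all fun w => !evenB w || ((wv w).eqb (wv []) ||
    ((wv (w ++ w ++ w ++ w ++ w)).eqb (wv []) ||
    ((wv (w ++ w ++ w)).eqb (wv []) &&
      ((parL k).any fun u => (wv (u ++ [1, 2])).eqb (wv (w ++ u))) ||
    ((parL k).any fun u => (wv (u ++ carry k ++ [0, 2])).eqb (wv (w ++ (u ++ carry k)))))))

set_option maxRecDepth 100000 in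
lemma closedB_true : ∀ k s : Fin 4, s ≠ k → closedB k s = true := by decide +kernel

set_option maxRecDepth 100000 in
lemma classB_true : ∀ k : Fin 4, classB k = true := by decide +kernel

lemma parabolic_list {k : Fin 4} {h : W535} (hh : h ∈ Subgroup.closure (Set.image S {k}ᶜ)) :
    ∃ w ∈ parL k, h = wp w := by
  have key : ∀ w ∈ parL k, ∀ s, s ≠ k → ∃ u ∈ parL k, wp w * S s = wp u := by
    intro w hw s hs
    have h1 := closedB_true k s hs
    rw [closedB, List.all_eq_true] at h1
    have h2 := h1 w hw
    rw [List.any_eq_true] at h2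
    obtain ⟨u, hu, h3⟩ := h2
    refine ⟨u, hu, ?_⟩
    rw [← wp_eq h3, wp_append, wp_cons, wp_nil, mul_one]
  induction hh using Subgroup.closure_induction_right with
  | one =>
    have hnil : ∀ k, [] ∈ parL k := by decide
    exact ⟨[], hnil k, wp_nil.symm⟩
  | mul_right x _ y hy ih =>
    obtain ⟨s, hs, rfl⟩ := hy
    obtain ⟨w, hw, rfl⟩ := ih
    exact key w hw s hs
  | mul_inv_cancel x _ y hy ih =>
    obtain ⟨s, hs, rfl⟩ := hy
    obtain ⟨w, hw, rfl⟩ := ih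
    rw [S_inv]
    exact key w hw s hs

/-- The sign homomorphism. -/
def sgn : W535 →* Multiplicative (ZMod 2) := csW.lengthParity

lemma sgn_S (i : Fin 4) : sgn (S i) = Multiplicative.ofAdd 1 := csW.lengthParity_simple i

lemma sgn_odd_ne : (Multiplicative.ofAdd 1 : Multiplicative (ZMod 2)) ≠ 1 := by decide

lemma sgn_wp (w : List (Fin 4)) :
    sgn (wp w) = if evenB w = true then 1 else Multiplicative.ofAdd 1 := by
  induction w with
  | nil => rw [wp_nil, map_one]; rfl
  | cons i w ih =>
    rw [wp_cons, map_mul, ih, sgn_S, evenB]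
    cases evenB w <;> decide

theorem classify {k : Fin 4} {h : W535} (hh : h ∈ Subgroup.closure (Set.image S {k}ᶜ))
    (hs : sgn h = 1) : h = 1 ∨ h ^ 5 = 1 ∨ IsConj h (S 0 * S 2) ∨ IsConj h (S 1 * S 2) := by
  obtain ⟨w, hw, rfl⟩ := parabolic_list hh
  have h1 := classB_true k
  rw [classB, List.all_eq_true] at h1
  have h2 := h1 w hw
  have he : evenB w = true := by
    by_contra hc
    rw [sgn_wp, if_neg hc] at hs
    exact sgn_odd_ne hs
  have conj_of : ∀ u t : List (Fin 4), wp (u ++ t) = wp (w ++ u) → IsConj (wp w) (wp t) := by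
    intro u t hut
    rw [wp_append, wp_append] at hut
    apply IsConj.symm
    rw [isConj_iff]
    exact ⟨wp u, by rw [hut, mul_inv_cancel_right]⟩
  have w2 : ∀ i j, wp [i, j] = S i * S j := by
    intro i j
    rw [wp_cons, wp_cons, wp_nil, mul_one]
  simp only [he, Bool.not_true, Bool.false_or, Bool.or_eq_true, Bool.and_eq_true,
    List.any_eq_true] at h2
  rcases h2 with h2 | h2 | ⟨-, ⟨u, -, h2⟩⟩ | ⟨u, -, h2⟩
  · left
    rw [wp_eq h2, wp_nil]
  · right; left
    have := wp_eq h2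
    rw [wp_append, wp_append, wp_append, wp_append, wp_nil] at this
    rw [← this]
    simp only [pow_succ, pow_zero, one_mul]
  · right; right; right
    rw [← w2]
    exact conj_of _ _ (wp_eq h2)
  · right; right; left
    rw [← w2]
    exact conj_of _ _ (wp_eq h2)

/-! ### Comparison of `Γ⁺` with the Coxeter group -/

abbrev gA : GammaPlus := PresentedGroup.of Gen.a
abbrev gB : GammaPlus := PresentedGroup.of Gen.b
abbrev gC : GammaPlus := PresentedGroup.of Gen.c

lemma rel_one {r : FreeGroup Gen} (h : r ∈ rels) : PresentedGroup.mk rels r = 1 :=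
  (PresentedGroup.one_of_mem h)

lemma gA2 : gA ^ 2 = 1 := rel_one (r := FreeGroup.of Gen.a ^ 2) (by simp [rels])
lemma gB2 : gB ^ 2 = 1 := rel_one (r := FreeGroup.of Gen.b ^ 2) (by simp [rels])
lemma gC5 : gC ^ 5 = 1 := rel_one (r := FreeGroup.of Gen.c ^ 5) (by simp [rels])
lemma gBC2 : (gB * gC) ^ 2 = 1 :=
  rel_one (r := (FreeGroup.of Gen.b * FreeGroup.of Gen.c) ^ 2) (by simp [rels])
lemma gCA3 : (gC * gA) ^ 3 = 1 :=
  rel_one (r := (FreeGroup.of Gen.c * FreeGroup.of Gen.a) ^ 3) (by simp [rels])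
lemma gAB5 : (gA * gB) ^ 5 = 1 :=
  rel_one (r := (FreeGroup.of Gen.a * FreeGroup.of Gen.b) ^ 5) (by simp [rels])

lemma gA_inv : gA⁻¹ = gA := by
  have := gA2
  rw [pow_two] at this
  exact inv_eq_of_mul_eq_one_left this
lemma gB_inv : gB⁻¹ = gB := by
  have := gB2
  rw [pow_two] at this
  exact inv_eq_of_mul_eq_one_left this

lemma pow_comm_one {G : Type*} [Group G] {x y : G} {n : ℕ} (h : (x * y) ^ n = 1) :
    (y * x) ^ n = 1 := by
  have : y * x = x⁻¹ * (x * y) * x⁻¹⁻¹ := by group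
  rw [this, conj_pow, h]
  group

lemma pow_inv_one {G : Type*} [Group G] {x : G} {n : ℕ} (h : x ^ n = 1) : x⁻¹ ^ n = 1 := by
  rw [inv_pow, h, inv_one]

lemma gCiA3 : (gC⁻¹ * gA) ^ 3 = 1 := by
  have h := pow_inv_one (pow_comm_one gCA3)
  rwa [mul_inv_rev, gA_inv] at h
lemma gCiB2 : (gC⁻¹ * gB) ^ 2 = 1 := by
  have h := pow_inv_one gBC2
  rwa [mul_inv_rev, gB_inv] at h

/-- Images of the generators under the automorphism inverting the generators. -/
def tauF : Gen → GammaPlus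
  | Gen.a => gA
  | Gen.b => gB
  | Gen.c => gC⁻¹

/-- Conjugation by the first reflection, as an endomorphism. -/
def tauHom : GammaPlus →* GammaPlus := PresentedGroup.toGroup (f := tauF) (by
  intro r hr
  simp only [rels, Set.mem_insert_iff, Set.mem_singleton_iff] at hr
  rcases hr with rfl | rfl | rfl | rfl | rfl | rfl <;>
    simp only [map_pow, map_mul, FreeGroup.lift_apply_of, tauF]
  · exact gA2
  · exact gB2
  · exact pow_inv_one gC5
  · exact pow_comm_one gCiB2
  · exact gCiA3
  · exact gAB5)

lemma tauHom_of (x : Gen) : tauHom (PresentedGroup.of x) = tauF x := PresentedGroup.toGroup.of _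

lemma tauHom_comp : tauHom.comp tauHom = MonoidHom.id GammaPlus := by
  apply PresentedGroup.ext
  intro x
  rw [MonoidHom.comp_apply, tauHom_of]
  cases x
  · exact tauHom_of _
  · exact tauHom_of _
  · simp only [tauF, map_inv, MonoidHom.id_apply]
    rw [tauHom_of, tauF, inv_inv]

/-- Conjugation by the first reflection, as an automorphism. -/
def tau : MulAut GammaPlus := MonoidHom.toMulEquiv tauHom tauHom tauHom_comp tauHom_comp

/-- The holomorph. -/
abbrev Hol := GammaPlus ⋊[MonoidHom.id (MulAut GammaPlus)] MulAut GammaPlus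

/-- Elements `r₀ rᵢ`. -/
def xg : Fin 4 → GammaPlus := ![1, gC, gA, gB]

lemma tau_xg (i : Fin 4) : tau (xg i) = (xg i)⁻¹ := by
  change tauHom (xg i) = _
  fin_cases i
  · simp [xg]
  · exact tauHom_of Gen.c
  · exact (tauHom_of Gen.a).trans gA_inv.symm
  · exact (tauHom_of Gen.b).trans gB_inv.symm

lemma tau_sq : tau * tau = 1 := by
  ext x
  exact congrArg (fun f : GammaPlus →* GammaPlus => f x) tauHom_comp

lemma xg_rel (i j : Fin 4) : ((xg i)⁻¹ * xg j) ^ cox535 i j = 1 := by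
  have hlt : ∀ i j : Fin 4, i < j → ((xg i)⁻¹ * xg j) ^ cox535 i j = 1 := by
    intro i j hij
    have c01 : (1⁻¹ * gC) ^ 5 = 1 := by rw [inv_one, one_mul]; exact gC5
    have c02 : (1⁻¹ * gA) ^ 2 = 1 := by rw [inv_one, one_mul]; exact gA2
    have c03 : (1⁻¹ * gB) ^ 2 = 1 := by rw [inv_one, one_mul]; exact gB2
    have c23 : (gA⁻¹ * gB) ^ 5 = 1 := by rw [gA_inv]; exact gAB5
    fin_cases i <;> fin_cases j <;> first
      | exact c01
      | exact c02
      | exact c03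
      | exact gCiA3
      | exact gCiB2
      | exact c23
      | (exfalso; revert hij; decide)
  rcases lt_trichotomy i j with h | rfl | h
  · exact hlt i j h
  · simp
  · have := pow_inv_one (hlt j i h)
    rwa [mul_inv_rev, inv_inv, cox535.symmetric] at this

/-- Images of the reflections in the holomorph. -/
def holS (i : Fin 4) : Hol := SemidirectProduct.inr tau * SemidirectProduct.inl (xg i)

lemma holS_mul (i j : Fin 4) : holS i * holS j = SemidirectProduct.inl ((xg i)⁻¹ * xg j) := by
  ext1
  · simp [holS, tau_xg]
  · simp [holS, tau_sq]

lemma holS_liftable : cox535.IsLiftable holS := by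
  intro i j
  rw [holS_mul, ← map_pow, xg_rel, map_one]

/-- The map from the Coxeter group to the holomorph. -/
noncomputable def toHol : W535 →* Hol := csW.lift ⟨holS, holS_liftable⟩

lemma toHol_S (i : Fin 4) : toHol (S i) = holS i := csW.lift_apply_simple holS_liftable i

/-- Images of the generators of `Γ⁺`. -/
def embF : Gen → W535
  | Gen.a => S 0 * S 2
  | Gen.b => S 0 * S 3
  | Gen.c => S 0 * S 1

lemma S_S (i : Fin 4) : S i * S i = 1 := csW.simple_mul_simple_self i

lemma S_pow (i j : Fin 4) : (S i * S j) ^ cox535 i j = 1 := csW.simple_mul_simple_pow i j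

/-- The embedding of `Γ⁺` in the Coxeter group. -/
def emb : GammaPlus →* W535 := PresentedGroup.toGroup (f := embF) (by
  intro r hr
  simp only [rels, Set.mem_insert_iff, Set.mem_singleton_iff] at hr
  have c02 : S 0 * S 2 = S 2 * S 0 := braid2 rfl
  have c03 : S 0 * S 3 = S 3 * S 0 := braid2 rfl
  rcases hr with rfl | rfl | rfl | rfl | rfl | rfl <;>
    simp only [map_pow, map_mul, FreeGroup.lift_apply_of, embF]
  · exact S_pow 0 2
  · exact S_pow 0 3
  · exact S_pow 0 1
  · have : S 0 * S 3 * (S 0 * S 1) = S 3 * S 1 := by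
      rw [c03, mul_assoc, ← mul_assoc (S 0) (S 0), S_S, one_mul]
    rw [this]; exact S_pow 3 1
  · apply pow_comm_one
    have : S 0 * S 2 * (S 0 * S 1) = S 2 * S 1 := by
      rw [c02, mul_assoc, ← mul_assoc (S 0) (S 0), S_S, one_mul]
    rw [this]; exact S_pow 2 1
  · have : S 0 * S 2 * (S 0 * S 3) = S 2 * S 3 := by
      rw [c02, mul_assoc, ← mul_assoc (S 0) (S 0), S_S, one_mul]
    rw [this]; exact S_pow 2 3)

lemma emb_of (x : Gen) : emb (PresentedGroup.of x) = embF x := PresentedGroup.toGroup.of _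

lemma emb_xg (i : Fin 4) : emb (xg i) = S 0 * S i := by
  fin_cases i
  · exact (map_one emb).trans (S_S 0).symm
  · exact emb_of Gen.c
  · exact emb_of Gen.a
  · exact emb_of Gen.b

lemma toHol_emb : toHol.comp emb = SemidirectProduct.inl := by
  have key : ∀ i, toHol (emb (xg i)) = SemidirectProduct.inl (xg i) := by
    intro i
    rw [emb_xg, map_mul, toHol_S, toHol_S, holS_mul]
    simp [xg]
  apply PresentedGroup.ext
  intro x
  cases x
  · exact key 2
  · exact key 3
  · exact key 1

lemma emb_injective : Function.Injective emb := by
  intro x y h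
  have h1 : toHol.comp emb x = toHol.comp emb y := congrArg toHol h
  rw [toHol_emb] at h1
  exact SemidirectProduct.inl_injective h1

lemma emb_range (w : W535) : (∃ γ, w = emb γ) ∨ ∃ γ, w = emb γ * S 0 := by
  induction w using csW.simple_induction_right with
  | one => exact Or.inl ⟨1, (map_one _).symm⟩
  | mul_simple_right w i ih =>
    rcases ih with ⟨γ, rfl⟩ | ⟨γ, rfl⟩
    · right
      refine ⟨γ * (xg i)⁻¹, ?_⟩
      rw [map_mul, map_inv, emb_xg, mul_inv_rev, S_inv, S_inv, ← mul_assoc, S_cancel]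
    · left
      refine ⟨γ * xg i, ?_⟩
      rw [map_mul, emb_xg, mul_assoc]

lemma sgn_emb (γ : GammaPlus) : sgn (emb γ) = 1 := by
  have : sgn.comp emb = 1 := by
    apply PresentedGroup.ext
    intro x
    rw [MonoidHom.comp_apply, emb_of]
    cases x <;> simp only [embF, map_mul, sgn_S] <;> decide
  exact congrArg (fun f : GammaPlus →* Multiplicative (ZMod 2) => f γ) this

lemma mem_range_of_even {w : W535} (h : sgn w = 1) : ∃ γ, w = emb γ := by
  rcases emb_range w with h1 | ⟨γ, rfl⟩
  · exact h1
  · rw [map_mul, sgn_emb, one_mul, sgn_S] at h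
    exact absurd h sgn_odd_ne

lemma sgn_cases (w : W535) : sgn w = 1 ∨ sgn w = Multiplicative.ofAdd 1 := by
  rcases emb_range w with ⟨γ, rfl⟩ | ⟨γ, rfl⟩
  · exact Or.inl (sgn_emb γ)
  · right; rw [map_mul, sgn_emb, one_mul, sgn_S]

/-- Conjugacy in the Coxeter group descends, given an odd element of the centralizer. -/
lemma isConj_descend {g t : GammaPlus} (h : IsConj (emb g) (emb t)) {z : W535}
    (hz : z * emb t = emb t * z) (hzs : sgn z = Multiplicative.ofAdd 1) : IsConj g t := by
  have fin : ∀ v : W535, sgn v = 1 → v * emb g * v⁻¹ = emb t → IsConj g t := by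
    intro v hv hc
    obtain ⟨γ, rfl⟩ := mem_range_of_even hv
    rw [isConj_iff]
    refine ⟨γ, emb_injective ?_⟩
    rw [map_mul, map_mul, map_inv, hc]
  obtain ⟨v, hv⟩ := isConj_iff.mp h
  rcases sgn_cases v with h1 | h1
  · exact fin v h1 hv
  · apply fin (z * v)
    · rw [map_mul, h1, hzs]; decide
    · have : z * v * emb g * (z * v)⁻¹ = z * (v * emb g * v⁻¹) * z⁻¹ := by group
      rw [this, hv, hz, mul_inv_cancel_right]

lemma conj_target {g : GammaPlus} {n : ℕ} (hn : orderOf g = n) (h2 : 1 < n) (h5 : ¬ n ∣ 5) :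
    IsConj (emb g) (S 0 * S 2) ∨ IsConj (emb g) (S 1 * S 2) := by
  have hpow : emb g ^ n = 1 := by rw [← map_pow, ← hn, pow_orderOf_eq_one, map_one]
  have hord : orderOf (emb g) = n := by rw [orderOf_injective emb emb_injective, hn]
  obtain ⟨u, k, hk⟩ := finite_order_parabolic (by omega) hpow
  have hc : IsConj (emb g) (u⁻¹ * emb g * u) := isConj_iff.mpr ⟨u⁻¹, by rw [inv_inv]⟩
  have ho : orderOf (u⁻¹ * emb g * u) = n := by
    have : u⁻¹ * emb g * u = MulAut.conj u⁻¹ (emb g) := by simp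
    rw [this, MulEquiv.orderOf_eq, hord]
  have hs : sgn (u⁻¹ * emb g * u) = 1 := by
    rw [map_mul, map_mul, sgn_emb, mul_one, ← map_mul, inv_mul_cancel, map_one]
  rcases classify hk hs with h | h | h | h
  · rw [h, orderOf_one] at ho; omega
  · have := orderOf_dvd_of_pow_eq_one h
    rw [ho] at this
    exact absurd this h5
  · exact Or.inl (hc.trans h)
  · exact Or.inr (hc.trans h)

lemma IsConj.pow_one {G : Type*} [Group G] {x y : G} (h : IsConj x y) {n : ℕ} (hy : y ^ n = 1) :
    x ^ n = 1 := by
  obtain ⟨c, hc⟩ := isConj_iff.mp h.symm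
  rw [← hc, conj_pow, hy]
  group

lemma t2_ne : S 0 * S 2 ≠ 1 := by
  intro h
  have h1 := rho_mul_S (S 0) 2 (e 2)
  rw [h, rho_S, sRefl_self, map_one, map_neg, sRefl_zero] at h1
  have h2 := congrFun h1 2
  simp [e] at h2
  linarith

lemma t3_ne : S 1 * S 2 ≠ 1 := by
  intro h
  have h1 := rho_mul_S (S 1) 2 (e 2)
  rw [h, rho_S, sRefl_self, map_one, map_neg, sRefl_one] at h1
  have h2 := congrFun h1 1
  simp [e] at h2

lemma emb_t3 : emb (gC⁻¹ * gA) = S 1 * S 2 := by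
  rw [map_mul, map_inv, emb_of, emb_of, embF, embF, mul_inv_rev, S_inv, S_inv, ← mul_assoc,
    S_cancel]

lemma order_two_conj {g : GammaPlus} (hg : orderOf g = 2) : IsConj g gA := by
  have ht : emb gA = S 0 * S 2 := emb_of Gen.a
  have hp : emb g ^ 2 = 1 := by rw [← map_pow, ← hg, pow_orderOf_eq_one, map_one]
  rcases conj_target hg (by norm_num) (by norm_num) with h | h
  · rw [← ht] at h
    refine isConj_descend h (z := S 0) ?_ (sgn_S 0)
    have c02 : S 0 * S 2 = S 2 * S 0 := braid2 rfl
    rw [ht, mul_assoc, ← c02]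
  · exfalso
    have h1 : emb g ^ 3 = 1 := h.pow_one (S_pow 1 2)
    have h2 : emb g = 1 := by rw [pow_succ, hp, one_mul] at h1; exact h1
    rw [h2] at h
    exact t3_ne (isConj_one_right.mp h)

lemma order_three_conj {g : GammaPlus} (hg : orderOf g = 3) : IsConj g (gC⁻¹ * gA) := by
  have hp : emb g ^ 3 = 1 := by rw [← map_pow, ← hg, pow_orderOf_eq_one, map_one]
  rcases conj_target hg (by norm_num) (by norm_num) with h | h
  · exfalso
    have h1 : emb g ^ 2 = 1 := h.pow_one (S_pow 0 2)
    have h2 : emb g = 1 := by rw [pow_succ, h1, one_mul] at hp; exact hp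
    rw [h2] at h
    exact t2_ne (isConj_one_right.mp h)
  · rw [← emb_t3] at h
    refine isConj_descend h (z := wp [0, 1, 2, 0, 1, 2, 0, 1, 2, 0, 1, 2, 0, 1, 2]) ?_ ?_
    · have ht : S 1 * S 2 = wp [1, 2] := by rw [wp_cons, wp_cons, wp_nil, mul_one]
      rw [emb_t3, ht, ← wp_append, ← wp_append]
      apply wp_eq
      decide +kernel
    · rw [sgn_wp]; decide

lemma order_gA : orderOf gA = 2 := by
  apply orderOf_eq_prime gA2
  intro h
  apply t2_ne
  have ht : emb gA = S 0 * S 2 := emb_of Gen.a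
  rw [← ht, h, map_one]

lemma order_gCA : orderOf (gC⁻¹ * gA) = 3 := by
  apply orderOf_eq_prime gCiA3
  intro h
  apply t3_ne
  rw [← emb_t3, h, map_one]

lemma card_one_of {n : ℕ} {t : GammaPlus} (ht : orderOf t = n)
    (h : ∀ g : GammaPlus, orderOf g = n → IsConj g t) :
    Nat.card {c : ConjClasses GammaPlus //
      ∃ g : GammaPlus, c = ConjClasses.mk g ∧ orderOf g = n} = 1 := by
  rw [Nat.card_eq_one_iff_exists]
  refine ⟨⟨ConjClasses.mk t, t, rfl, ht⟩, ?_⟩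
  rintro ⟨c, g, rfl, hg⟩
  exact Subtype.ext (ConjClasses.mk_eq_mk_iff_isConj.mpr (h g hg))

/-- The group `Γ⁺` contains exactly one conjugacy class of elements of order 2 and
exactly one conjugacy class of elements of order 3. -/
theorem gammaPlus_one_class_of_order_two_and_three :
    Nat.card {c : ConjClasses GammaPlus //
      ∃ g : GammaPlus, c = ConjClasses.mk g ∧ orderOf g = 2} = 1 ∧
    Nat.card {c : ConjClasses GammaPlus //
      ∃ g : GammaPlus, c = ConjClasses.mk g ∧ orderOf g = 3} = 1 :=
  ⟨card_one_of order_gA fun _ => order_two_conj, card_one_of order_gCA fun _ => order_three_conj⟩
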